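/- Let k be an algebraically closed field of characteristic 0 and q ∈ k^×. In the free algebra k⟨x_1,x_2,x_3⟩ define z_1 := x_2x_3 − q·x_3x_2. Let A be the quotient of k⟨x_1,x_2,x_3⟩ by the two-sided ideal generated by: x_1², x_2², x_1x_2 + x_2x_1, x_3², x_3·z_1 + q^{−1}·z_1·x_3, and x_1x_3 − q·x_3x_1. Then the images of the monomials x_1^{m_1}·x_2^{m_2}·x_3^{m_3}·z_1^{m_4}, with m_1, m_2, m_3 ∈ {0,1} and m_4 ∈ ℕ, form a k-basis of A, and GKdim A = 1. (A is the Endymion Nichols algebra B(eny_−(q)) of a pale block and a point with q_22 = −1 and weak interaction.) -/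

import Mathlib

open scoped ENNReal

/-- The Gelfand–Kirillov dimension of a `k`-algebra `A`. -/
noncomputable def GKdim (k A : Type*) [Field k] [Ring A] [Algebra k A] : ℝ≥0∞ :=
  ⨆ (V : Submodule k A) (_ : FiniteDimensional k V),
    Filter.limsup
      (fun n : ℕ =>
        ENNReal.ofReal
          (Real.log ((Module.finrank k (↥(∑ j ∈ Finset.range (n + 1), V ^ j)) : ℕ) : ℝ) /
            Real.log (n : ℝ)))
      Filter.atTop

/-- The generator `x_{i+1}` of the free algebra `k⟨x₁,x₂,x₃⟩`. -/
noncomputable def X (k : Type*) [Field k] (i : Fin 3) : FreeAlgebra k (Fin 3) :=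
  FreeAlgebra.ι k i

/-- `z₁ := x₂x₃ − q x₃x₂`. -/
noncomputable def z1 (k : Type*) [Field k] (q : k) : FreeAlgebra k (Fin 3) :=
  X k 1 * X k 2 - q • (X k 2 * X k 1)

/-- The defining relations of the Endymion algebra `B(eny₋(q))`. -/
def enyRel (k : Type*) [Field k] (q : k)
    (a b : FreeAlgebra k (Fin 3)) : Prop :=
  b = 0 ∧
    (a = X k 0 * X k 0 ∨
     a = X k 1 * X k 1 ∨
     a = X k 0 * X k 1 + X k 1 * X k 0 ∨
     a = X k 2 * X k 2 ∨
     a = X k 2 * z1 k q + q⁻¹ • (z1 k q * X k 2) ∨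
     a = X k 0 * X k 2 - q • (X k 2 * X k 0))

/-- The PBW monomials `x₁^{m₁} x₂^{m₂} x₃^{m₃} z₁^{m₄}`, `m₁, m₂, m₃ ∈ {0,1}`, `m₄ ∈ ℕ`. -/
noncomputable def bas (k : Type*) [Field k] (q : k)
    (p : Fin 2 × Fin 2 × Fin 2 × ℕ) : RingQuot (enyRel k q) :=
  RingQuot.mkAlgHom k (enyRel k q)
    (X k 0 ^ ((p.1 : ℕ)) * X k 1 ^ ((p.2.1 : ℕ)) * X k 2 ^ ((p.2.2.1 : ℕ)) *
      z1 k q ^ p.2.2.2)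

namespace Eny

open Filter Topology

section Relations

variable {k : Type*} [Field k] (q : k)

/-- The image of the generator `x_{i+1}` in the Endymion algebra. -/
noncomputable def gen (i : Fin 3) : RingQuot (enyRel k q) :=
  RingQuot.mkAlgHom k (enyRel k q) (X k i)

/-- The image of `z₁` in the Endymion algebra. -/
noncomputable def zed : RingQuot (enyRel k q) :=
  RingQuot.mkAlgHom k (enyRel k q) (z1 k q)

theorem bas_eq (i j l : Fin 2) (n : ℕ) :
    bas k q (i, j, l, n) =
      gen q 0 ^ (i : ℕ) * gen q 1 ^ (j : ℕ) * gen q 2 ^ (l : ℕ) * zed q ^ n := by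
  simp [bas, gen, zed]

theorem zed_eq : zed q = gen q 1 * gen q 2 - q • (gen q 2 * gen q 1) := by
  simp [zed, z1, gen]

theorem gen_zero_sq : gen q 0 * gen q 0 = 0 := by
  simpa [gen] using RingQuot.mkAlgHom_rel k (s := enyRel k q)
    (show enyRel k q (X k 0 * X k 0) 0 from ⟨rfl, by tauto⟩)

theorem gen_one_sq : gen q 1 * gen q 1 = 0 := by
  simpa [gen] using RingQuot.mkAlgHom_rel k (s := enyRel k q)
    (show enyRel k q (X k 1 * X k 1) 0 from ⟨rfl, by tauto⟩)

theorem gen_two_sq : gen q 2 * gen q 2 = 0 := by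
  simpa [gen] using RingQuot.mkAlgHom_rel k (s := enyRel k q)
    (show enyRel k q (X k 2 * X k 2) 0 from ⟨rfl, by tauto⟩)

theorem gen_one_mul_gen_zero : gen q 1 * gen q 0 = (-1 : k) • (gen q 0 * gen q 1) := by
  have h := RingQuot.mkAlgHom_rel k (s := enyRel k q)
    (show enyRel k q (X k 0 * X k 1 + X k 1 * X k 0) 0 from ⟨rfl, by tauto⟩)
  simp only [map_add, map_mul, map_zero] at h
  exact (eq_neg_of_add_eq_zero_right h).trans (neg_one_smul k _).symm

theorem gen_two_mul_gen_zero (hq : q ≠ 0) :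
    gen q 2 * gen q 0 = q⁻¹ • (gen q 0 * gen q 2) := by
  have h := RingQuot.mkAlgHom_rel k (s := enyRel k q)
    (show enyRel k q (X k 0 * X k 2 - q • (X k 2 * X k 0)) 0 from ⟨rfl, by tauto⟩)
  simp only [map_sub, map_mul, map_smul, map_zero] at h
  rw [eq_inv_smul_iff₀ hq]
  exact (sub_eq_zero.mp h).symm

theorem gen_two_mul_gen_one (hq : q ≠ 0) :
    gen q 2 * gen q 1 = q⁻¹ • (gen q 1 * gen q 2 - zed q) := by
  rw [eq_inv_smul_iff₀ hq, zed_eq]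
  abel

theorem gen_two_mul_gen_one_mul_gen_two :
    gen q 2 * gen q 1 * gen q 2 = gen q 2 * zed q := by
  rw [zed_eq, mul_sub, mul_smul_comm, ← mul_assoc, ← mul_assoc, gen_two_sq]
  simp

end Relations

section Filtration

variable {k : Type*} [Field k] (q : k)

/-- The degree of a PBW monomial, each generator `x_i` having degree one. -/
def deg (p : Fin 2 × Fin 2 × Fin 2 × ℕ) : ℕ :=
  p.1 + p.2.1 + p.2.2.1 + 2 * p.2.2.2

/-- The span of the PBW monomials of degree at most `N`. -/
noncomputable def filt (N : ℕ) : Submodule k (RingQuot (enyRel k q)) :=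
  Submodule.span k (bas k q '' {p | deg p ≤ N})

theorem bas_mem_filt {p : Fin 2 × Fin 2 × Fin 2 × ℕ} {N : ℕ} (h : deg p ≤ N) :
    bas k q p ∈ filt q N :=
  Submodule.subset_span ⟨p, h, rfl⟩

theorem filt_mono {M N : ℕ} (h : M ≤ N) : filt q M ≤ filt q N :=
  Submodule.span_mono (Set.image_mono fun _ hp => le_trans hp h)

theorem gen_zero_mul_bas_mem (p : Fin 2 × Fin 2 × Fin 2 × ℕ) :
    gen q 0 * bas k q p ∈ filt q (deg p + 1) := by
  obtain ⟨i, j, l, n⟩ := p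
  fin_cases i
  · convert bas_mem_filt q (p := (1, j, l, n)) _ using 1
    · simp [bas_eq, mul_assoc]
    · simp [deg]; omega
  · simp [bas_eq, ← mul_assoc, gen_zero_sq]

theorem gen_one_mul_bas_mem (p : Fin 2 × Fin 2 × Fin 2 × ℕ) :
    gen q 1 * bas k q p ∈ filt q (deg p + 1) := by
  obtain ⟨i, j, l, n⟩ := p
  fin_cases j
  · fin_cases i
    · convert bas_mem_filt q (p := (0, 1, l, n)) _ using 1
      · simp [bas_eq, mul_assoc]
      · simp [deg]; omega
    · convert Submodule.smul_mem _ (-1 : k) (bas_mem_filt q (p := (1, 1, l, n)) _) using 1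
      · simp [bas_eq, ← mul_assoc, gen_one_mul_gen_zero, -neg_smul]
      · simp [deg]; omega
  · fin_cases i
    · simp [bas_eq, ← mul_assoc, gen_one_sq]
    · simp [bas_eq, ← mul_assoc, gen_one_mul_gen_zero,
        mul_assoc (gen q 0) (gen q 1) (gen q 1), gen_one_sq]

theorem mul_mem_filt_of_mul_bas_mem {d : ℕ} {x : RingQuot (enyRel k q)}
    (hx : ∀ p, x * bas k q p ∈ filt q (deg p + d)) {N : ℕ} {v : RingQuot (enyRel k q)}
    (hv : v ∈ filt q N) : x * v ∈ filt q (N + d) := by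
  induction hv using Submodule.span_induction with
  | mem v hv =>
    obtain ⟨p, hp, rfl⟩ := hv
    exact filt_mono q (Nat.add_le_add_right hp d) (hx p)
  | zero => simp
  | add v w _ _ hv hw => rw [mul_add]; exact add_mem hv hw
  | smul c v _ hv => rw [mul_smul_comm]; exact Submodule.smul_mem _ c hv

theorem gen_two_mul_bas_mem (hq : q ≠ 0) (p : Fin 2 × Fin 2 × Fin 2 × ℕ) :
    gen q 2 * bas k q p ∈ filt q (deg p + 1) := by
  have base (j l : Fin 2) (n : ℕ) :
      gen q 2 * bas k q (0, j, l, n) ∈ filt q (deg (0, j, l, n) + 1) := by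
    fin_cases j <;> fin_cases l
    · convert bas_mem_filt q (p := (0, 0, 1, n)) _ using 1
      · simp [bas_eq]
      · simp [deg]; omega
    · simp [bas_eq, ← mul_assoc, gen_two_sq]
    · have h : gen q 2 * bas k q (0, 1, 0, n) =
          q⁻¹ • (bas k q (0, 1, 1, n) - bas k q (0, 0, 0, n + 1)) := by
        simp [bas_eq, ← mul_assoc, gen_two_mul_gen_one q hq, sub_mul, pow_succ']
      refine h ▸ Submodule.smul_mem _ _ (sub_mem ?_ ?_) <;>
      · refine bas_mem_filt q ?_
        simp [deg]; try omega
    · convert bas_mem_filt q (p := (0, 0, 1, n + 1)) _ using 1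
      · simp [bas_eq, ← mul_assoc, gen_two_mul_gen_one_mul_gen_two, pow_succ']
      · simp [deg]; omega
  obtain ⟨i, j, l, n⟩ := p
  fin_cases i
  · exact base j l n
  · have h : gen q 2 * bas k q (1, j, l, n) =
        q⁻¹ • (gen q 0 * (gen q 2 * bas k q (0, j, l, n))) := by
      simp [bas_eq, ← mul_assoc, gen_two_mul_gen_zero q hq]
    have hd : deg (1, j, l, n) = deg (0, j, l, n) + 1 := by simp [deg]; omega
    change gen q 2 * bas k q (1, j, l, n) ∈ filt q (deg (1, j, l, n) + 1)
    rw [h, hd]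
    exact Submodule.smul_mem _ _
      (mul_mem_filt_of_mul_bas_mem q (gen_zero_mul_bas_mem q) (base j l n))

theorem gen_mul_mem_filt (hq : q ≠ 0) (i : Fin 3) {N : ℕ} {v : RingQuot (enyRel k q)}
    (hv : v ∈ filt q N) : gen q i * v ∈ filt q (N + 1) := by
  refine mul_mem_filt_of_mul_bas_mem q (fun p => ?_) hv
  fin_cases i
  exacts [gen_zero_mul_bas_mem q p, gen_one_mul_bas_mem q p, gen_two_mul_bas_mem q hq p]

theorem zed_mul_mem_filt (hq : q ≠ 0) {N : ℕ} {v : RingQuot (enyRel k q)}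
    (hv : v ∈ filt q N) : zed q * v ∈ filt q (N + 2) := by
  rw [zed_eq, sub_mul, smul_mul_assoc, mul_assoc, mul_assoc]
  exact sub_mem (gen_mul_mem_filt q hq 1 (gen_mul_mem_filt q hq 2 hv))
    (Submodule.smul_mem _ _ (gen_mul_mem_filt q hq 2 (gen_mul_mem_filt q hq 1 hv)))

theorem pow_mul_mem_filt {x : RingQuot (enyRel k q)} {d : ℕ}
    (hx : ∀ {N : ℕ} {v : RingQuot (enyRel k q)}, v ∈ filt q N → x * v ∈ filt q (N + d))
    (n : ℕ) {N : ℕ} {v : RingQuot (enyRel k q)} (hv : v ∈ filt q N) :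
    x ^ n * v ∈ filt q (N + d * n) := by
  induction n with
  | zero => simpa using hv
  | succ n ih => rw [pow_succ', mul_assoc, Nat.mul_succ, ← add_assoc]; exact hx ih

theorem bas_mul_mem_filt (hq : q ≠ 0) (p : Fin 2 × Fin 2 × Fin 2 × ℕ) {N : ℕ}
    {v : RingQuot (enyRel k q)} (hv : v ∈ filt q N) :
    bas k q p * v ∈ filt q (deg p + N) := by
  obtain ⟨i, j, l, n⟩ := p
  simp only [bas_eq, mul_assoc]
  refine filt_mono q (le_of_eq ?_)
    (pow_mul_mem_filt q (gen_mul_mem_filt q hq 0) i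
      (pow_mul_mem_filt q (gen_mul_mem_filt q hq 1) j
        (pow_mul_mem_filt q (gen_mul_mem_filt q hq 2) l
          (pow_mul_mem_filt q (zed_mul_mem_filt q hq) n hv))))
  simp only [deg]
  omega

theorem filt_mul_le (hq : q ≠ 0) (M N : ℕ) : filt q M * filt q N ≤ filt q (M + N) := by
  rw [Submodule.mul_le]
  intro u hu v hv
  induction hu using Submodule.span_induction with
  | mem u hu =>
    obtain ⟨p, hp, rfl⟩ := hu
    exact filt_mono q (Nat.add_le_add_right hp N) (bas_mul_mem_filt q hq p hv)
  | zero => simp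
  | add u w _ _ hu hw => rw [add_mul]; exact add_mem hu hw
  | smul c u _ hu => rw [smul_mul_assoc]; exact Submodule.smul_mem _ c hu

theorem one_mem_filt (N : ℕ) : (1 : RingQuot (enyRel k q)) ∈ filt q N := by
  convert bas_mem_filt q (p := (0, 0, 0, 0)) (Nat.zero_le N)
  simp [bas_eq]

theorem filt_pow_le (hq : q ≠ 0) (M j : ℕ) : filt q M ^ j ≤ filt q (M * j) := by
  induction j with
  | zero =>
    rw [pow_zero, Submodule.one_le]
    exact one_mem_filt q _
  | succ j ih =>
    rw [pow_succ, Nat.mul_succ]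
    exact (mul_le_mul_left ih _).trans (filt_mul_le q hq _ _)

theorem exists_mem_filt (hq : q ≠ 0) (x : RingQuot (enyRel k q)) : ∃ N, x ∈ filt q N := by
  obtain ⟨x, rfl⟩ := RingQuot.mkAlgHom_surjective k (enyRel k q) x
  induction x using FreeAlgebra.induction with
  | grade0 c =>
    refine ⟨0, ?_⟩
    rw [AlgHom.commutes, Algebra.algebraMap_eq_smul_one]
    exact Submodule.smul_mem _ _ (one_mem_filt q 0)
  | grade1 i =>
    refine ⟨0 + 1, ?_⟩
    simpa [gen, X] using gen_mul_mem_filt q hq i (one_mem_filt q 0)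
  | mul x y hx hy =>
    obtain ⟨M, hM⟩ := hx
    obtain ⟨N, hN⟩ := hy
    exact ⟨M + N, by rw [map_mul]; exact filt_mul_le q hq M N (Submodule.mul_mem_mul hM hN)⟩
  | add x y hx hy =>
    obtain ⟨M, hM⟩ := hx
    obtain ⟨N, hN⟩ := hy
    exact ⟨max M N, by
      rw [map_add]
      exact add_mem (filt_mono q (le_max_left M N) hM) (filt_mono q (le_max_right M N) hN)⟩

theorem span_bas (hq : q ≠ 0) : Submodule.span k (Set.range (bas k q)) = ⊤ := by
  refine Submodule.eq_top_iff'.mpr fun x => ?_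
  obtain ⟨N, hN⟩ := exists_mem_filt q hq x
  exact Submodule.span_mono (Set.image_subset_range _ _) hN

theorem exists_le_filt (hq : q ≠ 0) (V : Submodule k (RingQuot (enyRel k q)))
    [FiniteDimensional k V] : ∃ N, V ≤ filt q N := by
  refine Submodule.fg_induction (motive := fun V _ => ∃ N, V ≤ filt q N) (fun x => ?_) ?_ V
    (Module.Finite.iff_fg.mp inferInstance)
  · simpa [Submodule.span_singleton_le_iff_mem] using exists_mem_filt q hq x
  · rintro V W _ _ ⟨M, hM⟩ ⟨N, hN⟩
    exact ⟨max M N, sup_le (hM.trans (filt_mono q (le_max_left M N)))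
      (hN.trans (filt_mono q (le_max_right M N)))⟩

theorem filt_le_span_finset (N : ℕ) [DecidableEq (RingQuot (enyRel k q))] :
    filt q N ≤ Submodule.span k
      ((((Finset.univ ×ˢ Finset.univ ×ˢ Finset.univ ×ˢ Finset.range (N + 1)).image
        (bas k q) : Finset _)) : Set (RingQuot (enyRel k q))) := by
  refine Submodule.span_mono ?_
  rintro _ ⟨p, hp, rfl⟩
  simp only [Set.mem_ofPred_eq, deg] at hp
  refine Finset.mem_coe.mpr (Finset.mem_image_of_mem _ ?_)
  simp
  omega

theorem finrank_le_of_le_filt {V : Submodule k (RingQuot (enyRel k q))} {N : ℕ}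
    (h : V ≤ filt q N) : Module.finrank k V ≤ 8 * (N + 1) := by
  classical
  refine (Submodule.finrank_mono (h.trans (filt_le_span_finset q N))).trans
    ((finrank_span_finset_le_card _).trans (Finset.card_image_le.trans ?_))
  simp
  omega

theorem sum_pow_le_filt (hq : q ≠ 0) {V : Submodule k (RingQuot (enyRel k q))} {M : ℕ}
    (h : V ≤ filt q M) (n : ℕ) : ∑ j ∈ Finset.range (n + 1), V ^ j ≤ filt q (M * n) := by
  refine Finset.sum_induction _ (fun W => W ≤ filt q (M * n)) (fun _ _ => sup_le)
    bot_le fun j hj => ?_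
  exact (pow_le_pow_left' h j).trans ((filt_pow_le q hq M j).trans
    (filt_mono q (Nat.mul_le_mul_left M (Nat.lt_succ_iff.mp (Finset.mem_range.mp hj)))))

end Filtration

section Representation

variable {k : Type*} [Field k] (q : k)

/-- The vector space with basis the PBW monomials. -/
abbrev PBW (k : Type*) [Field k] := (Fin 2 × Fin 2 × Fin 2 × ℕ) →₀ k

/-- The basis vector of the PBW space indexed by a monomial. -/
noncomputable def mon (p : Fin 2 × Fin 2 × Fin 2 × ℕ) : PBW k := Finsupp.single p 1

/-- The endomorphism of the PBW space with prescribed values on monomials. -/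
noncomputable def extend (f : Fin 2 × Fin 2 × Fin 2 × ℕ → PBW k) : Module.End k (PBW k) :=
  Finsupp.linearCombination k f

theorem extend_mon (f : Fin 2 × Fin 2 × Fin 2 × ℕ → PBW k)
    (p : Fin 2 × Fin 2 × Fin 2 × ℕ) : extend f (mon p) = f p := by
  simp [extend, mon]

theorem end_ext {f g : Module.End k (PBW k)} (h : ∀ p, f (mon p) = g (mon p)) : f = g :=
  Finsupp.basisSingleOne.ext fun p => by simpa [mon] using h p

/-- Left multiplication by `x₁` on PBW monomials. -/
noncomputable def opOne : Module.End k (PBW k) :=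
  extend fun (i, p) => ![mon (1, p), 0] i

/-- Left multiplication by `x₂` on PBW monomials. -/
noncomputable def opTwo : Module.End k (PBW k) :=
  extend fun (i, j, p) => ![![mon (0, 1, p), 0], ![-mon (1, 1, p), 0]] i j

/-- Left multiplication by `x₃` on PBW monomials. -/
noncomputable def opThree : Module.End k (PBW k) :=
  extend fun (i, j, l, n) => q⁻¹ ^ (i : ℕ) •
    ![![mon (i, 0, 1, n), 0],
      ![q⁻¹ • (mon (i, 1, 1, n) - mon (i, 0, 0, n + 1)), mon (i, 0, 1, n + 1)]] j l

/-- The action of the free algebra on the PBW space. -/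
noncomputable def freeAct : FreeAlgebra k (Fin 3) →ₐ[k] Module.End k (PBW k) :=
  FreeAlgebra.lift k ![opOne, opTwo, opThree q]

theorem freeAct_X_zero : freeAct q (X k 0) = opOne := by simp [freeAct, X]

theorem freeAct_X_one : freeAct q (X k 1) = opTwo := by simp [freeAct, X]

theorem freeAct_X_two : freeAct q (X k 2) = opThree q := by simp [freeAct, X]

theorem freeAct_z1 :
    freeAct q (z1 k q) = opTwo * opThree q - q • (opThree q * opTwo) := by
  simp [z1, freeAct_X_one, freeAct_X_two]

theorem freeAct_rel (hq : q ≠ 0) ⦃a b : FreeAlgebra k (Fin 3)⦄ (h : enyRel k q a b) :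
    freeAct q a = freeAct q b := by
  obtain ⟨rfl, h⟩ := h
  rcases h with rfl | rfl | rfl | rfl | rfl | rfl <;>
  · refine end_ext fun p => ?_
    obtain ⟨i, j, l, n⟩ := p
    simp only [map_add, map_sub, map_smul, map_mul, map_zero, freeAct_X_zero, freeAct_X_one,
      freeAct_X_two, freeAct_z1]
    fin_cases i <;> fin_cases j <;> fin_cases l <;>
      simp [opOne, opTwo, opThree, extend_mon] <;>
      match_scalars <;> field_simp <;> ring

/-- The Endymion algebra acts on the PBW space. -/
noncomputable def act (hq : q ≠ 0) : RingQuot (enyRel k q) →ₐ[k] Module.End k (PBW k) :=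
  RingQuot.liftAlgHom k ⟨freeAct q, freeAct_rel q hq⟩

theorem freeAct_z1_pow (hq : q ≠ 0) (n : ℕ) :
    (freeAct q (z1 k q) ^ n) (mon (0, 0, 0, 0)) = mon (0, 0, 0, n) := by
  induction n with
  | zero => simp
  | succ n ih =>
    rw [pow_succ', Module.End.mul_apply, ih, freeAct_z1]
    simp [opTwo, opThree, extend_mon, hq]

theorem act_bas (hq : q ≠ 0) (p : Fin 2 × Fin 2 × Fin 2 × ℕ) :
    act q hq (bas k q p) (mon (0, 0, 0, 0)) = mon p := by
  obtain ⟨i, j, l, n⟩ := p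
  simp only [act, bas, RingQuot.liftAlgHom_mkAlgHom_apply, map_mul, map_pow,
    Module.End.mul_apply, freeAct_z1_pow q hq, freeAct_X_zero, freeAct_X_one, freeAct_X_two]
  fin_cases i <;> fin_cases j <;> fin_cases l <;>
    simp [opOne, opTwo, opThree, extend_mon]

theorem linearIndependent_bas (hq : q ≠ 0) : LinearIndependent k (bas k q) := by
  refine LinearIndependent.of_comp
    ((LinearMap.applyₗ (mon (0, 0, 0, 0) : PBW k)).comp (act q hq).toLinearMap) ?_
  convert (Finsupp.basisSingleOne (R := k) (ι := Fin 2 × Fin 2 × Fin 2 × ℕ)).linearIndependent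

  ext1 p
  simpa [mon] using act_bas q hq p

end Representation

section GelfandKirillov

variable {k : Type*} [Field k] (q : k)

theorem limsup_log_div_log_le_one {f : ℕ → ℕ} {C : ℕ} (h : ∀ n, 1 ≤ n → f n ≤ C * n) :
    limsup (fun n : ℕ => ENNReal.ofReal (Real.log (f n) / Real.log n)) atTop ≤ 1 := by
  have hlim : Tendsto (fun n : ℕ => ENNReal.ofReal (Real.log (C + 1) / Real.log n + 1))
      atTop (𝓝 1) := by
    rw [← ENNReal.ofReal_one]
    refine ENNReal.tendsto_ofReal ?_
    have := ((Real.tendsto_log_atTop.comp tendsto_natCast_atTop_atTop).const_div_atTop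
      (Real.log (C + 1))).add_const 1
    simpa using this
  rw [← hlim.limsup_eq]
  refine limsup_le_limsup ?_
  filter_upwards [eventually_ge_atTop 2] with n hn
  refine ENNReal.ofReal_le_ofReal ?_
  have hn' : (2 : ℝ) ≤ n := by exact_mod_cast hn
  have hlog : 0 < Real.log n := Real.log_pos (by linarith)
  have hC : 0 ≤ Real.log ((C : ℝ) + 1) := Real.log_nonneg (by simp)
  rw [div_add_one hlog.ne']
  gcongr
  rw [← Real.log_mul (by positivity) (by positivity)]
  rcases Nat.eq_zero_or_pos (f n) with h0 | h0
  · rw [h0, Nat.cast_zero, Real.log_zero, Real.log_mul (by positivity) (by positivity)]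
    positivity
  · refine Real.log_le_log (by exact_mod_cast h0) ?_
    exact_mod_cast (h n (by omega)).trans (Nat.mul_le_mul_right n (Nat.le_succ C))

theorem GKdim_le_one (hq : q ≠ 0) : GKdim k (RingQuot (enyRel k q)) ≤ 1 := by
  refine iSup₂_le fun V _ => ?_
  obtain ⟨M, hM⟩ := exists_le_filt q hq V
  refine limsup_log_div_log_le_one (C := 8 * (M + 1)) fun n hn => ?_
  refine (finrank_le_of_le_filt q (sum_pow_le_filt q hq hM n)).trans ?_
  nlinarith

theorem lt_finrank_sum_pow_span_zed (hq : q ≠ 0) (n : ℕ) :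
    n < Module.finrank k
      ↥(∑ j ∈ Finset.range (n + 1), Submodule.span k {zed q} ^ j) := by
  set W := ∑ j ∈ Finset.range (n + 1), Submodule.span k {zed q} ^ j
  have hmem (j : Fin (n + 1)) : zed q ^ (j : ℕ) ∈ W := by
    refine Finset.single_le_sum (f := fun j => Submodule.span k {zed q} ^ j)
      (fun _ _ => bot_le) (Finset.mem_range.mpr j.2) ?_
    exact Submodule.pow_mem_pow _ (Submodule.mem_span_singleton_self _) _
  obtain ⟨M, hM⟩ := exists_le_filt q hq (Submodule.span k {zed q})
  have hfin : FiniteDimensional k W := by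
    classical
    exact Submodule.finiteDimensional_of_le
      ((sum_pow_le_filt q hq hM n).trans (filt_le_span_finset q _))
  have hli : LinearIndependent k fun j : Fin (n + 1) => (⟨_, hmem j⟩ : W) := by
    refine LinearIndependent.of_comp W.subtype ?_
    convert (linearIndependent_bas q hq).comp
      (fun j : Fin (n + 1) => ((0, 0, 0, (j : ℕ)) : Fin 2 × Fin 2 × Fin 2 × ℕ)) ?_ using 1
    · ext j
      simp [bas_eq]
    · intro i j h
      simpa [Fin.ext_iff] using h
  simpa using hli.fintype_card_le_finrank

theorem one_le_GKdim (hq : q ≠ 0) : 1 ≤ GKdim k (RingQuot (enyRel k q)) := by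
  refine le_iSup₂_of_le (Submodule.span k {zed q}) inferInstance ?_
  refine le_limsup_of_frequently_le (Eventually.frequently ?_)
  filter_upwards [eventually_ge_atTop 2] with n hn
  have hn' : (2 : ℝ) ≤ n := by exact_mod_cast hn
  rw [ENNReal.one_le_ofReal, one_le_div (Real.log_pos (by linarith))]
  refine Real.log_le_log (by linarith) ?_
  exact_mod_cast (lt_finrank_sum_pow_span_zed q hq n).le

end GelfandKirillov

end Eny

/-- The PBW monomials form a basis of `B(eny₋(q))`, and
`GKdim B(eny₋(q)) = 1`. -/
theorem statement16 (k : Type*) [Field k] [IsAlgClosed k] [CharZero k]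
    (q : k) (hq : q ≠ 0) :
    (LinearIndependent k (bas k q) ∧
      Submodule.span k (Set.range (bas k q)) = ⊤) ∧
    GKdim k (RingQuot (enyRel k q)) = 1 :=
  ⟨⟨Eny.linearIndependent_bas q hq, Eny.span_bas q hq⟩,
    le_antisymm (Eny.GKdim_le_one q hq) (Eny.one_le_GKdim q hq)⟩
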